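/- A finite simple graph G is a bipartite chain graph if and only if G contains no induced subgraph isomorphic to 2K2, C3, or C5. -/

import Mathlib

open SimpleGraph

/-- The graph `2K₂`: four vertices `{0,1,2,3}` with exactly the two edges `0-1` and `2-3`. -/
def twoK2 : SimpleGraph (Fin 4) := SimpleGraph.fromEdgeSet {s(0, 1), s(2, 3)}

/-- `G` contains an induced subgraph isomorphic to `H`. -/
def HasInducedSubgraph {V W : Type*} (G : SimpleGraph V) (H : SimpleGraph W) : Prop :=
  ∃ s : Set V, Nonempty (G.induce s ≃g H)

/-- The set `X` admits a nested neighborhood ordering in `G`: there is an enumeration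
`(v 1, …, v k)` of `X` with `N(v 1) \ X ⊆ N(v 2) \ X ⊆ … ⊆ N(v k) \ X`. -/
def HasNNO {V : Type*} (G : SimpleGraph V) (X : Set V) : Prop :=
  ∃ l : List V, l.Nodup ∧ {a | a ∈ l} = X ∧
    l.Chain' fun a b => G.neighborSet a \ X ⊆ G.neighborSet b \ X

/-- `G` is a bipartite chain graph: it is bipartite with some bipartition `(U, W)` such
that `U` admits a nested neighborhood ordering. -/
def IsBipartiteChain {V : Type*} (G : SimpleGraph V) : Prop :=
  ∃ U W : Set V, U ∪ W = Set.univ ∧ Disjoint U W ∧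
    (∀ a b : V, G.Adj a b → (a ∈ U ∧ b ∈ W) ∨ (a ∈ W ∧ b ∈ U)) ∧ HasNNO G U

theorem hasInducedSubgraph_iff_nonempty_embedding {V W : Type*} {G : SimpleGraph V}
    {H : SimpleGraph W} : HasInducedSubgraph G H ↔ Nonempty (H ↪g G) := by
  constructor
  · rintro ⟨s, ⟨e⟩⟩
    exact ⟨(Embedding.induce s).comp e.symm.toEmbedding⟩
  · rintro ⟨f⟩
    refine ⟨Set.range f, ⟨RelIso.symm ⟨Equiv.ofInjective f f.injective, ?_⟩⟩⟩
    intro a b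
    simp

theorem twoK2_adj_iff (i j : Fin 4) : twoK2.Adj i j ↔
    (i = 0 ∧ j = 1) ∨ (i = 1 ∧ j = 0) ∨ (i = 2 ∧ j = 3) ∨ (i = 3 ∧ j = 2) := by
  simp only [twoK2, fromEdgeSet_adj, Set.mem_insert_iff, Set.mem_singleton_iff, Sym2.eq_iff]
  grind

theorem hasInducedSubgraph_twoK2 {V : Type*} {G : SimpleGraph V} {a b c d : V}
    (hab : G.Adj a b) (hcd : G.Adj c d) (hac : ¬ G.Adj a c) (had : ¬ G.Adj a d)
    (hbc : ¬ G.Adj b c) (hbd : ¬ G.Adj b d) : HasInducedSubgraph G twoK2 := by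
  rw [hasInducedSubgraph_iff_nonempty_embedding]
  have h₁ := hab.symm
  have h₂ := hcd.symm
  have h₃ : ¬ G.Adj c a := fun h => hac h.symm
  have h₄ : ¬ G.Adj d a := fun h => had h.symm
  have h₅ : ¬ G.Adj c b := fun h => hbc h.symm
  have h₆ : ¬ G.Adj d b := fun h => hbd h.symm
  have n₁ := hab.ne
  have n₂ := hcd.ne
  have n₃ : a ≠ c := by rintro rfl; contradiction
  have n₄ : a ≠ d := by rintro rfl; contradiction
  have n₅ : b ≠ c := by rintro rfl; contradiction
  have n₆ : b ≠ d := by rintro rfl; contradiction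
  refine ⟨⟨⟨![a, b, c, d], ?_⟩, ?_⟩⟩
  · intro i j h
    fin_cases i <;> fin_cases j <;> simp_all [eq_comm]
  · intro i j
    change G.Adj (![a, b, c, d] i) (![a, b, c, d] j) ↔ _
    rw [twoK2_adj_iff]
    fin_cases i <;> fin_cases j <;> simp_all

theorem hasInducedSubgraph_cycleGraph_three {V : Type*} {G : SimpleGraph V} {a b c : V}
    (hab : G.Adj a b) (hbc : G.Adj b c) (hca : G.Adj c a) :
    HasInducedSubgraph G (cycleGraph 3) := by
  rw [hasInducedSubgraph_iff_nonempty_embedding]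
  have h₁ := hab.symm
  have h₂ := hbc.symm
  have h₃ := hca.symm
  have n₁ := hab.ne
  have n₂ := hbc.ne
  have n₃ := h₃.ne
  refine ⟨⟨⟨![a, b, c], ?_⟩, ?_⟩⟩
  · intro i j h
    fin_cases i <;> fin_cases j <;> simp_all [eq_comm]
  · intro i j
    change G.Adj (![a, b, c] i) (![a, b, c] j) ↔ _
    fin_cases i <;> fin_cases j <;> simp_all [cycleGraph_adj] <;> decide

theorem hasInducedSubgraph_cycleGraph_five {V : Type*} {G : SimpleGraph V} {a b c d e : V}
    (hab : G.Adj a b) (hbc : G.Adj b c) (hcd : G.Adj c d) (hde : G.Adj d e) (hea : G.Adj e a)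
    (hac : ¬ G.Adj a c) (had : ¬ G.Adj a d) (hbd : ¬ G.Adj b d) (hbe : ¬ G.Adj b e)
    (hce : ¬ G.Adj c e) : HasInducedSubgraph G (cycleGraph 5) := by
  rw [hasInducedSubgraph_iff_nonempty_embedding]
  have h₁ := hab.symm
  have h₂ := hbc.symm
  have h₃ := hcd.symm
  have h₄ := hde.symm
  have h₅ := hea.symm
  have k₁ : ¬ G.Adj c a := fun h => hac h.symm
  have k₂ : ¬ G.Adj d a := fun h => had h.symm
  have k₃ : ¬ G.Adj d b := fun h => hbd h.symm
  have k₄ : ¬ G.Adj e b := fun h => hbe h.symm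
  have k₅ : ¬ G.Adj e c := fun h => hce h.symm
  have n₁ := hab.ne
  have n₂ := hbc.ne
  have n₃ := hcd.ne
  have n₄ := hde.ne
  have n₅ := h₅.ne
  have m₁ : a ≠ c := by rintro rfl; contradiction
  have m₂ : a ≠ d := by rintro rfl; contradiction
  have m₃ : b ≠ d := by rintro rfl; contradiction
  have m₄ : b ≠ e := by rintro rfl; contradiction
  have m₅ : c ≠ e := by rintro rfl; contradiction
  refine ⟨⟨⟨![a, b, c, d, e], ?_⟩, ?_⟩⟩
  · intro i j h
    fin_cases i <;> fin_cases j <;> simp_all [eq_comm]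
  · intro i j
    change G.Adj (![a, b, c, d, e] i) (![a, b, c, d, e] j) ↔ _
    fin_cases i <;> fin_cases j <;> simp_all [cycleGraph_adj] <;> decide

theorem hasNNO_of_forall_subset_or_subset {V : Type*} [Finite V] {G : SimpleGraph V} {X : Set V}
    (h : ∀ a ∈ X, ∀ b ∈ X, G.neighborSet a \ X ⊆ G.neighborSet b \ X ∨
      G.neighborSet b \ X ⊆ G.neighborSet a \ X) : HasNNO G X := by
  classical
  let r : V → V → Prop := fun a b => (G.neighborSet a \ X).ncard ≤ (G.neighborSet b \ X).ncard
  have : Std.Total r := ⟨fun a b => Nat.le_total _ _⟩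
  have : IsTrans V r := ⟨fun a b c => Nat.le_trans⟩
  let l := X.toFinite.toFinset.toList
  have hmem : ∀ a, a ∈ l.insertionSort r ↔ a ∈ X := by simp [l]
  refine ⟨l.insertionSort r, ?_, by ext a; exact hmem a, ?_⟩
  · exact (List.perm_insertionSort r l).nodup_iff.2 (Finset.nodup_toList _)
  · refine List.Pairwise.isChain ((List.pairwise_insertionSort r l).imp_of_mem ?_)
    intro a b ha hb hab
    rcases h a ((hmem a).1 ha) b ((hmem b).1 hb) with h | h
    · exact h
    · exact (Set.eq_of_subset_of_ncard_le h hab (Set.toFinite _)).ge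

theorem HasNNO.subset_or_subset {V : Type*} {G : SimpleGraph V} {X : Set V} (h : HasNNO G X)
    {a b : V} (ha : a ∈ X) (hb : b ∈ X) : G.neighborSet a \ X ⊆ G.neighborSet b \ X ∨
      G.neighborSet b \ X ⊆ G.neighborSet a \ X := by
  obtain ⟨l, -, rfl, hl⟩ := h
  set X : Set V := {a | a ∈ l}
  let r : V → V → Prop := fun a b => G.neighborSet a \ X ⊆ G.neighborSet b \ X
  have : IsTrans V r := ⟨fun a b c => Set.Subset.trans⟩
  have hp : l.Pairwise r := List.isChain_iff_pairwise.1 hl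
  have : Std.Symm fun a b => r a b ∨ r b a := ⟨fun _ _ h => h.symm⟩
  exact List.Pairwise.forall_of_forall (R := fun a b => r a b ∨ r b a)
    (fun _ _ => Or.inl subset_rfl) (hp.imp Or.inl) ha hb

theorem IsBipartiteChain.of_no_induced {V : Type*} [Finite V] {G : SimpleGraph V}
    (h₂ : ¬ HasInducedSubgraph G twoK2) (h₃ : ¬ HasInducedSubgraph G (cycleGraph 3))
    (h₅ : ¬ HasInducedSubgraph G (cycleGraph 5)) : IsBipartiteChain G := by
  rcases isEmpty_or_nonempty V with hV | hV
  · exact ⟨∅, ∅, Subsingleton.elim _ _, Set.disjoint_empty _, fun a => hV.elim a,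
      hasNNO_of_forall_subset_or_subset fun a => hV.elim a⟩
  obtain ⟨v, hv⟩ := Finite.exists_max fun v => (G.neighborSet v).ncard
  have tri {a b c : V} (hab : G.Adj a b) (hac : G.Adj a c) : ¬ G.Adj b c := fun hbc =>
    h₃ (hasInducedSubgraph_cycleGraph_three hab hbc hac.symm)
  have key {x y : V} (hx : ¬ G.Adj v x) (hy : ¬ G.Adj v y) (hxy : G.Adj x y)
      (hsub : ∀ u, G.Adj v u → G.Adj x u) : False := by
    have hss : G.neighborSet v ⊂ G.neighborSet x :=
      ⟨hsub, fun h => hy (h hxy)⟩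
    exact (Set.ncard_lt_ncard hss (Set.toFinite _)).not_ge (hv x)
  have indep {x y : V} (hx : ¬ G.Adj v x) (hy : ¬ G.Adj v y) : ¬ G.Adj x y := by
    intro hxy
    have hor (u : V) (hu : G.Adj v u) : G.Adj x u ∨ G.Adj y u := by
      by_contra! h
      exact h₂ (hasInducedSubgraph_twoK2 hu hxy hx hy (fun h' => h.1 h'.symm)
        (fun h' => h.2 h'.symm))
    by_cases hA : ∀ u, G.Adj v u → G.Adj x u
    · exact key hx hy hxy hA
    by_cases hB : ∀ u, G.Adj v u → G.Adj y u
    · exact key hy hx hxy.symm hB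
    push Not at hA hB
    obtain ⟨b, hb, hxb⟩ := hA
    obtain ⟨a, ha, hya⟩ := hB
    have hxa := (hor a ha).resolve_right hya
    have hyb := (hor b hb).resolve_left hxb
    exact h₅ (hasInducedSubgraph_cycleGraph_five ha hxa.symm hxy hyb hb.symm hx hy
      (fun h => hya h.symm) (tri ha hb) hxb)
  refine ⟨G.neighborSet v, (G.neighborSet v)ᶜ, Set.union_compl_self _, disjoint_compl_right,
    ?_, hasNNO_of_forall_subset_or_subset ?_⟩
  · intro a b hab
    by_cases ha : G.Adj v a <;> by_cases hb : G.Adj v b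
    · exact absurd hab (tri ha hb)
    · exact Or.inl ⟨ha, hb⟩
    · exact Or.inr ⟨ha, hb⟩
    · exact absurd hab (indep ha hb)
  · intro a ha b hb
    by_contra! h
    obtain ⟨⟨c, ⟨hac, hc⟩, hbc⟩, ⟨d, ⟨hbd, hd⟩, had⟩⟩ :=
      And.imp Set.not_subset.1 Set.not_subset.1 h
    exact h₂ (hasInducedSubgraph_twoK2 hac hbd (tri ha hb) (fun h => had ⟨h, hd⟩)
      (fun h => hbc ⟨h.symm, hc⟩) (indep hc hd))

theorem IsBipartiteChain.not_hasInducedSubgraph_twoK2 {V : Type*} {G : SimpleGraph V}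
    (h : IsBipartiteChain G) : ¬ HasInducedSubgraph G twoK2 := by
  rw [hasInducedSubgraph_iff_nonempty_embedding]
  rintro ⟨f⟩
  obtain ⟨U, W, -, hd, hUW, hnno⟩ := h
  rw [Set.disjoint_left] at hd
  have hadj (i j : Fin 4) : G.Adj (f i) (f j) ↔
      (i = 0 ∧ j = 1) ∨ (i = 1 ∧ j = 0) ∨ (i = 2 ∧ j = 3) ∨ (i = 3 ∧ j = 2) := by
    rw [f.map_adj_iff, twoK2_adj_iff]
  have key {i j k m : Fin 4} (hi : f i ∈ U) (hk : f k ∈ U) (hj : f j ∈ W) (hm : f m ∈ W)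
      (hij : G.Adj (f i) (f j)) (hkm : G.Adj (f k) (f m)) (him : ¬ G.Adj (f i) (f m))
      (hkj : ¬ G.Adj (f k) (f j)) : False := by
    rcases hnno.subset_or_subset hi hk with h | h
    · exact hkj (h ⟨hij, fun h => hd h hj⟩).1
    · exact him (h ⟨hkm, fun h => hd h hm⟩).1
  have h01 : G.Adj (f 0) (f 1) := by simp [hadj]
  have h23 : G.Adj (f 2) (f 3) := by simp [hadj]
  rcases hUW _ _ h01 with ⟨h0, h1⟩ | ⟨h0, h1⟩ <;> rcases hUW _ _ h23 with ⟨h2, h3⟩ | ⟨h2, h3⟩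
  · exact key h0 h2 h1 h3 h01 h23 (by simp [hadj]) (by simp [hadj])
  · exact key h0 h3 h1 h2 h01 h23.symm (by simp [hadj]) (by simp [hadj])
  · exact key h1 h2 h0 h3 h01.symm h23 (by simp [hadj]) (by simp [hadj])
  · exact key h1 h3 h0 h2 h01.symm h23.symm (by simp [hadj]) (by simp [hadj])

theorem IsBipartiteChain.isBipartite {V : Type*} {G : SimpleGraph V}
    (h : IsBipartiteChain G) : G.IsBipartite := by
  obtain ⟨U, W, -, hd, hUW, -⟩ := h
  exact IsBipartiteWith.isBipartite ⟨hd, fun _ _ hab => hUW _ _ hab⟩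

theorem IsBipartiteChain.not_hasInducedSubgraph_cycleGraph {V : Type*} {G : SimpleGraph V}
    (h : IsBipartiteChain G) {n : ℕ} (hn : 2 ≤ n) (hodd : Odd n) :
    ¬ HasInducedSubgraph G (cycleGraph n) := by
  rw [hasInducedSubgraph_iff_nonempty_embedding]
  rintro ⟨f⟩
  have hc : (cycleGraph n).Colorable 2 := Colorable.of_hom f.toHom h.isBipartite
  have := hc.chromaticNumber_le
  rw [chromaticNumber_cycleGraph_of_odd n hn hodd] at this
  exact absurd this (by decide)

/-- A finite simple graph `G` is a bipartite chain graph if and only if `G` contains no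
induced subgraph isomorphic to `2K₂`, `C₃`, or `C₅`. -/
theorem isBipartiteChain_iff_no_induced_twoK2_C3_C5 {V : Type*} [Fintype V]
    (G : SimpleGraph V) :
    IsBipartiteChain G ↔ ¬ HasInducedSubgraph G twoK2 ∧
      ¬ HasInducedSubgraph G (cycleGraph 3) ∧ ¬ HasInducedSubgraph G (cycleGraph 5) := by
  refine ⟨fun h => ⟨h.not_hasInducedSubgraph_twoK2,
    h.not_hasInducedSubgraph_cycleGraph (by decide) (by decide),
    h.not_hasInducedSubgraph_cycleGraph (by decide) (by decide)⟩, ?_⟩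
  rintro ⟨h₂, h₃, h₅⟩
  exact .of_no_induced h₂ h₃ h₅
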